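/- Let S be a regular ring, I ⊆ S a prime ideal such that R = S/I is a complete intersection in codimension k, n ⊆ S a maximal ideal containing I, and m = n/I. Then the m-adic completion R̂ of R is a complete intersection in codimension k. -/

import Mathlib

noncomputable section

open PrimeSpectrum

/-- The height of an ideal. -/
def idealHeight {A : Type*} [CommRing A] (I : Ideal A) : ℕ∞ :=
  ⨅ p : {q : PrimeSpectrum A // I ≤ q.asIdeal}, Order.height (p : PrimeSpectrum A)

/-- A Noetherian local ring is regular if its maximal ideal is generated by
(Krull dimension) many elements. -/
def IsRegularLocal (A : Type*) [CommRing A] [IsLocalRing A] : Prop :=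
  IsNoetherianRing A ∧ ∃ fs : Finset A, Ideal.span (fs : Set A) = IsLocalRing.maximalIdeal A ∧
    ((fs.card : ℕ∞) : WithBot ℕ∞) = ringKrullDim A

/-- For an ideal `I` of a regular ring `S` and a prime `q ⊇ I`, the quotient `(S/I)_q` is a
complete intersection: the localized ideal `I_q` is generated by height-many elements. -/
def IsCIAt {S : Type*} [CommRing S] (I : Ideal S) (q : PrimeSpectrum S) : Prop :=
  ∃ fs : Finset (Localization.AtPrime q.asIdeal),
    Ideal.span (fs : Set (Localization.AtPrime q.asIdeal)) =
      I.map (algebraMap S (Localization.AtPrime q.asIdeal)) ∧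
    (fs.card : ℕ∞) = idealHeight (I.map (algebraMap S (Localization.AtPrime q.asIdeal)))

/-- `S/I` is a complete intersection in codimension `k`: for every prime of `S/I`
of height at most `k` the localization is a complete intersection. -/
def IsCIinCodim {S : Type*} [CommRing S] (I : Ideal S) (k : ℕ∞) : Prop :=
  ∀ (q : PrimeSpectrum S) (P : PrimeSpectrum (S ⧸ I)),
    q.asIdeal = P.asIdeal.comap (Ideal.Quotient.mk I) → Order.height P ≤ k → IsCIAt I q

theorem height_comap_le_aux {A B : Type*} [CommRing A] [CommRing B] (f : A →+* B)
    (hf : GeneralizingMap (PrimeSpectrum.comap f)) (q : PrimeSpectrum B) :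
    Order.height (PrimeSpectrum.comap f q) ≤ Order.height q := by
  let := f.toAlgebra
  have : Algebra.HasGoingDown A B :=
    Algebra.HasGoingDown.iff_generalizingMap_primeSpectrumComap.mpr hf
  refine Order.height_le fun l hl => ?_
  have : q.asIdeal.LiesOver l.last.asIdeal := ⟨by rw [hl]; rfl⟩
  obtain ⟨L, h1, h2, -⟩ := Ideal.exists_ltSeries_of_hasGoingDown l q.asIdeal
  rw [← h1]
  exact Order.length_le_height (by rw [h2])

theorem generalizing_quot_aux {A B : Type*} [CommRing A] [CommRing B] (f : A →+* B)
    (hf : GeneralizingMap (PrimeSpectrum.comap f)) (I : Ideal A) :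
    GeneralizingMap (PrimeSpectrum.comap
      (Ideal.quotientMap (I.map f) f Ideal.le_comap_map : A ⧸ I →+* B ⧸ I.map f)) := by
  intro q p hp
  rw [← PrimeSpectrum.le_iff_specializes] at hp
  have hp' : PrimeSpectrum.comap (Ideal.Quotient.mk I) p ≤
      PrimeSpectrum.comap f (PrimeSpectrum.comap (Ideal.Quotient.mk (I.map f)) q) := by
    intro x hx
    have := hp hx
    simpa using this
  obtain ⟨P, hP1, hP2⟩ := hf ((PrimeSpectrum.le_iff_specializes _ _).mp hp')
  rw [← PrimeSpectrum.le_iff_specializes] at hP1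
  have hIP : I.map f ≤ P.asIdeal := by
    rw [Ideal.map_le_iff_le_comap]
    intro x hx
    have h : x ∈ (PrimeSpectrum.comap f P).asIdeal := by
      rw [hP2]
      simp [Ideal.Quotient.eq_zero_iff_mem.mpr hx]
    exact h
  have hmem : P ∈ Set.range (PrimeSpectrum.comap (Ideal.Quotient.mk (I.map f))) := by
    rw [range_comap_of_surjective _ _ Ideal.Quotient.mk_surjective]
    simpa [PrimeSpectrum.mem_zeroLocus] using hIP
  obtain ⟨P', rfl⟩ := hmem
  refine ⟨P', (PrimeSpectrum.le_iff_specializes _ _).mp ?_, ?_⟩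
  · intro x hx
    obtain ⟨x, rfl⟩ := Ideal.Quotient.mk_surjective x
    exact hP1 hx
  · apply PrimeSpectrum.comap_injective_of_surjective (Ideal.Quotient.mk I)
      Ideal.Quotient.mk_surjective
    rw [← hP2]
    rfl

theorem noeth_completion_aux {P S : Type*} [CommRing P] [CommRing S] (g : P →+* S)
    (hg : Function.Surjective g) (V : Ideal P) (hV : V.FG)
    [IsNoetherianRing (AdicCompletion V P)] :
    IsNoetherianRing (AdicCompletion (V.map g) S) := by
  set n := V.map g with hn
  have hpow : ∀ k, V ^ k ≤ (n ^ k).comap g := fun k => by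
    rw [← Ideal.map_le_iff_le_comap, Ideal.map_pow]
  let F : (k : ℕ) → AdicCompletion V P →+* S ⧸ n ^ k := fun k =>
    (Ideal.quotientMap (n ^ k) g (hpow k)).comp (AdicCompletion.evalₐ V k : _ →+* _)
  have hF : ∀ {m k : ℕ} (hle : m ≤ k), (Ideal.Quotient.factorPow n hle).comp (F k) = F m := by
    intro m k hle
    ext x
    induction x using AdicCompletion.induction_on with
    | h x =>
      simp only [F, RingHom.comp_apply, RingHom.coe_coe, AdicCompletion.evalₐ_mk,
        Ideal.quotientMap_mk]
      have h1 : x.val k - x.val m ∈ V ^ m := by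
        have := (x.2 hle)
        rw [SModEq.sub_mem] at this
        simpa using (Submodule.neg_mem _ this)
      have h2 : (Ideal.Quotient.factorPow n hle) (Ideal.Quotient.mk (n ^ k) (g (x.val k))) =
        Ideal.Quotient.mk (n ^ m) (g (x.val k)) := rfl
      rw [h2, Ideal.Quotient.mk_eq_mk_iff_sub_mem, ← map_sub]
      exact hpow m h1
  let f := AdicCompletion.liftRingHom n F hF
  have hfa : ∀ p : P, f (algebraMap P _ p) = algebraMap S _ (g p) := by
    intro p
    apply AdicCompletion.ext_evalₐ
    intro k
    rw [AdicCompletion.evalₐ_liftRingHom]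
    simp [F]
  have hnFG : n.FG := hV.map g
  let W := V.map (algebraMap P (AdicCompletion V P))
  have hW : W.map f = n.map (algebraMap S (AdicCompletion n S)) := by
    have : f.comp (algebraMap P _) = (algebraMap S (AdicCompletion n S)).comp g :=
      RingHom.ext hfa
    rw [Ideal.map_map, this, ← Ideal.map_map]
  have c1 : IsAdicComplete W (AdicCompletion V P) :=
    (IsAdicComplete.map_algebraMap_iff _ _).mpr (AdicCompletion.isAdicComplete hV)
  have c2 : IsAdicComplete (W.map f) (AdicCompletion n S) := by
    rw [hW]
    exact (IsAdicComplete.map_algebraMap_iff _ _).mpr (AdicCompletion.isAdicComplete hnFG)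
  have hsurj : Function.Surjective f := by
    apply surjective_of_mk_map_comp_surjective (I := W)
    intro y
    obtain ⟨y, rfl⟩ := Ideal.Quotient.mk_surjective y
    obtain ⟨s, hs⟩ := Ideal.Quotient.mk_surjective (AdicCompletion.evalOneₐ n y)
    obtain ⟨p, rfl⟩ := hg s
    refine ⟨algebraMap P _ p, ?_⟩
    rw [RingHom.comp_apply, hfa, Ideal.Quotient.mk_eq_mk_iff_sub_mem, hW,
      ← AdicCompletion.ker_evalOneₐ_eq_map n hnFG, RingHom.mem_ker]
    have : (AdicCompletion.evalOneₐ n) (algebraMap S (AdicCompletion n S) (g p)) =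
      Ideal.Quotient.mk n (g p) := AlgHom.commutes _ _
    change AdicCompletion.evalOneₐ n _ = 0
    rw [map_sub, this, hs, sub_self]
  exact isNoetherianRing_of_surjective _ _ f hsurj

theorem noeth_completion {S : Type*} [CommRing S] [IsNoetherianRing S] (n : Ideal S) :
    IsNoetherianRing (AdicCompletion n S) := by
  obtain ⟨s, hs⟩ := IsNoetherian.noetherian n
  let g : MvPolynomial s S →+* S := (MvPolynomial.aeval (R := S) (fun i : s => (i : S))).toRingHom
  have hg : Function.Surjective g := fun x => ⟨MvPolynomial.C x, by simp [g]⟩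
  have hV : (MvPolynomial.idealOfVars s S).map g = n := by
    rw [MvPolynomial.idealOfVars, Ideal.map_span, ← Set.range_comp, ← hs]
    change Ideal.span _ = Ideal.span _
    congr 1
    ext x
    simp [g]
  have := isNoetherianRing_of_ringEquiv (MvPowerSeries s S)
    (MvPowerSeries.toAdicCompletionAlgEquiv s S).toRingEquiv
  have h := noeth_completion_aux g hg _ (MvPolynomial.idealOfVars_fg s S)
  rwa [hV] at h

theorem main_aux {A B : Type*} [CommRing A] [CommRing B] [IsNoetherianRing B] [Nontrivial B]
    (f : A →+* B) (hf : f.Flat) (I : Ideal A) (hI : I.map f ≠ ⊤) (fs : Finset A)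
    (h1 : Ideal.span (fs : Set A) = I) (h2 : (fs.card : ℕ∞) = idealHeight I) :
    ∃ gs : Finset B, Ideal.span (gs : Set B) = I.map f ∧
      (gs.card : ℕ∞) = idealHeight (I.map f) := by
  classical
  have hspan : Ideal.span ((fs.image f : Finset B) : Set B) = I.map f := by
    rw [← h1, Ideal.map_span, Finset.coe_image]
  refine ⟨fs.image f, hspan, le_antisymm ?_ ?_⟩
  · refine le_trans (Nat.cast_le.mpr Finset.card_image_le) ?_
    rw [h2]
    refine le_iInf fun Q => ?_
    refine le_trans ?_ (height_comap_le_aux f hf.generalizingMap_comap Q.1)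
    exact iInf_le (fun p : {q : PrimeSpectrum A // I ≤ q.asIdeal} =>
      Order.height (p : PrimeSpectrum A)) ⟨PrimeSpectrum.comap f Q.1,
        Ideal.map_le_iff_le_comap.mp Q.2⟩
  · obtain ⟨J, hJ⟩ := Ideal.nonempty_minimalPrimes hI
    have hJp : J.IsPrime := hJ.1.1
    rw [← hspan] at hJ
    have := Ideal.height_le_card_of_mem_minimalPrimes_span_finset hJ
    refine le_trans (iInf_le _ ⟨⟨J, hJp⟩, hspan ▸ hJ.1.2⟩) ?_
    rwa [← PrimeSpectrum.height_eq_orderHeight]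

/-- Let S be a regular (Noetherian) ring, I ⊆ S a prime ideal such that
R = S/I is a complete intersection in codimension k, n a maximal ideal containing I, and
m = n/I.  Then the m-adic completion R̂ of R (viewed as Ŝ/IŜ, where Ŝ is the n-adic
completion of S) is a complete intersection in codimension k. -/
theorem completion_isCIinCodim (S : Type*) [CommRing S] [IsNoetherianRing S]
    (hreg : ∀ q : PrimeSpectrum S, IsRegularLocal (Localization.AtPrime q.asIdeal))
    (I : Ideal S) (hI : I.IsPrime) (k : ℕ∞) (hCI : IsCIinCodim I k)
    (n : Ideal S) (hn : n.IsMaximal) (hIn : I ≤ n) :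
    IsCIinCodim (I.map (algebraMap S (AdicCompletion n S))) k := by
  set f := algebraMap S (AdicCompletion n S) with hfdef
  intro q P hqP hk
  have hflat : f.Flat :=
    RingHom.flat_algebraMap_iff.mpr inferInstance
  have hN : IsNoetherianRing (AdicCompletion n S) := noeth_completion n
  let p : PrimeSpectrum S := PrimeSpectrum.comap f q
  let P0 : PrimeSpectrum (S ⧸ I) := PrimeSpectrum.comap
    (Ideal.quotientMap (I.map f) f Ideal.le_comap_map) P
  have hp : p.asIdeal = P0.asIdeal.comap (Ideal.Quotient.mk I) := by
    change q.asIdeal.comap f = _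
    rw [hqP]
    rfl
  have hP0 : Order.height P0 ≤ k :=
    (height_comap_le_aux _ (generalizing_quot_aux f hflat.generalizingMap_comap I) P).trans hk
  obtain ⟨fs, h1, h2⟩ := hCI p P0 hp hP0
  let φ := Localization.localRingHom p.asIdeal q.asIdeal f rfl
  have hφ : φ.Flat := hflat.localRingHom q.asIdeal p.asIdeal rfl
  have hmap : (I.map (algebraMap S (Localization.AtPrime p.asIdeal))).map φ =
      (I.map f).map (algebraMap _ (Localization.AtPrime q.asIdeal)) := by
    rw [Ideal.map_map, Ideal.map_map]
    congr 1
    ext x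
    exact Localization.localRingHom_to_map p.asIdeal q.asIdeal f rfl x
  have hIq : I.map f ≤ q.asIdeal := by
    rw [hqP]
    intro x hx
    simp [Ideal.Quotient.eq_zero_iff_mem.mpr hx]
  have hne : (I.map (algebraMap S (Localization.AtPrime p.asIdeal))).map φ ≠ ⊤ := by
    rw [hmap]
    intro h
    have h3 := Ideal.map_mono (f := algebraMap _ (Localization.AtPrime q.asIdeal)) hIq
    rw [h, Localization.AtPrime.map_eq_maximalIdeal] at h3
    exact (IsLocalRing.maximalIdeal.isMaximal _).ne_top (top_le_iff.mp h3)
  have hNq : IsNoetherianRing (Localization.AtPrime q.asIdeal) :=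
    IsLocalization.isNoetherianRing q.asIdeal.primeCompl _ hN
  obtain ⟨gs, h3, h4⟩ := main_aux φ hφ _ hne fs h1 h2
  exact ⟨gs, by rw [h3, hmap], by rw [h4, hmap]⟩
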